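/- arXiv:math/0605030 — 3 statements merged into one kernel-verified Lean document; each statement's English description precedes it below -/
import Mathlib

section
/- Let ℙ be a dense subfield of ℝ, E a vector lattice over ℙ, E~ the Dedekind complete vector lattice of order bounded ℙ-linear functionals from E to ℝ, and 𝒫 a generating set of band projections on E~. Then for positive functionals f, g ∈ E~ the following holds: g lies in the band {f}^⊥⊥ generated by f in E~ if and only if for every x ∈ E₊ and every real ε > 0 there exists a real δ > 0 such that, for every p ∈ 𝒫, (pf)(x) ≤ δ implies (pg)(x) ≤ ε. -/
/-! Statement 12: For a generating set `𝒫` of band projections on `E~` and positive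
functionals `f, g ∈ E~`: `g ∈ {f}^⊥⊥` iff for every `x ∈ E₊` and `ε > 0` there is `δ > 0`
such that `(pf)(x) ≤ δ` implies `(pg)(x) ≤ ε` for every `p ∈ 𝒫`. -/

universe u

variable {P : Subfield ℝ} {E : Type u}

/-- Order bounded `ℙ`-linear functional. -/
def OrderBoundedF [Lattice E] [AddCommGroup E] [Module P E] (f : E →ₗ[↥P] ℝ) : Prop :=
  ∀ a b : E, ∃ c d : ℝ, ∀ x : E, a ≤ x → x ≤ b → c ≤ f x ∧ f x ≤ d

/-- The order of `E~`: `f ≤ g` iff `f x ≤ g x` for all `x ≥ 0`. -/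
def fLE [Lattice E] [AddCommGroup E] [Module P E] (f g : E →ₗ[↥P] ℝ) : Prop :=
  ∀ x : E, 0 ≤ x → f x ≤ g x

/-- `s` is the supremum in `E~` of a set `A` of functionals. -/
def IsLUBf [Lattice E] [AddCommGroup E] [Module P E]
    (A : Set (E →ₗ[↥P] ℝ)) (s : E →ₗ[↥P] ℝ) : Prop :=
  OrderBoundedF s ∧ (∀ a ∈ A, fLE a s) ∧
    ∀ w : E →ₗ[↥P] ℝ, OrderBoundedF w → (∀ a ∈ A, fLE a w) → fLE s w

/-- `m = |h|` in `E~`: the supremum of `{h, -h}`. -/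
def IsModF [Lattice E] [AddCommGroup E] [Module P E] (h m : E →ₗ[↥P] ℝ) : Prop :=
  IsLUBf {h, -h} m

/-- The infimum in `E~` of the two positive functionals `u, v` is zero. -/
def InfZeroF [Lattice E] [AddCommGroup E] [Module P E] (u v : E →ₗ[↥P] ℝ) : Prop :=
  fLE 0 u ∧ fLE 0 v ∧
    ∀ w : E →ₗ[↥P] ℝ, OrderBoundedF w → fLE w u → fLE w v → fLE w 0

/-- Disjointness in `E~`: `|u| ∧ |v| = 0`. -/
def DisjointF [Lattice E] [AddCommGroup E] [Module P E] (u v : E →ₗ[↥P] ℝ) : Prop :=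
  ∃ mu mv : E →ₗ[↥P] ℝ, IsModF u mu ∧ IsModF v mv ∧ InfZeroF mu mv

/-- `g` belongs to the band `{f}^⊥⊥` generated by `f` in `E~`. -/
def InBandF [Lattice E] [AddCommGroup E] [Module P E] (f g : E →ₗ[↥P] ℝ) : Prop :=
  ∀ h : E →ₗ[↥P] ℝ, OrderBoundedF h → DisjointF h f → DisjointF g h

/-- A band projection on `E~`. -/
def IsBandProjF [Lattice E] [AddCommGroup E] [Module P E]
    (p : (E →ₗ[↥P] ℝ) → (E →ₗ[↥P] ℝ)) : Prop :=
  (∀ f g : E →ₗ[↥P] ℝ, p (f + g) = p f + p g) ∧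
  (∀ (c : ℝ) (f : E →ₗ[↥P] ℝ), p (c • f) = c • p f) ∧
  (∀ f : E →ₗ[↥P] ℝ, p (p f) = p f) ∧
  (∀ f : E →ₗ[↥P] ℝ, OrderBoundedF f → OrderBoundedF (p f)) ∧
  (∀ f : E →ₗ[↥P] ℝ, OrderBoundedF f → fLE 0 f → fLE 0 (p f) ∧ fLE (p f) f)

section Helpers

variable [Lattice E] [AddCommGroup E] [Module P E] [IsOrderedAddMonoid E]

/-- Positive functionals are order bounded. -/
lemma OrderBoundedF.of_nonneg {f : E →ₗ[↥P] ℝ} (hf : fLE 0 f) : OrderBoundedF f := by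
  intro a b
  refine ⟨f a, f b, fun x hax hxb => ?_⟩
  have h₁ := hf (x - a) (sub_nonneg.2 hax)
  have h₂ := hf (b - x) (sub_nonneg.2 hxb)
  simp only [LinearMap.zero_apply, map_sub] at h₁ h₂
  constructor <;> linarith

/-- A positive functional is its own modulus. -/
lemma IsModF.of_nonneg {f : E →ₗ[↥P] ℝ} (hf : fLE 0 f) : IsModF f f := by
  refine ⟨.of_nonneg hf, ?_, fun w _ hw => hw f (by simp)⟩
  rintro a (rfl | rfl) x hx
  · exact le_rfl
  · have := hf x hx
    simp only [LinearMap.zero_apply, LinearMap.neg_apply] at this ⊢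
    linarith

/-- Band projections are monotone. -/
lemma IsBandProjF.mono {p : (E →ₗ[↥P] ℝ) → (E →ₗ[↥P] ℝ)} (hp : IsBandProjF p)
    {a b : E →ₗ[↥P] ℝ} (hab : fLE a b) : fLE (p a) (p b) := by
  have hd : fLE 0 (b - a) := fun x hx => by simpa using hab x hx
  intro x hx
  have h₁ := (hp.2.2.2.2 _ (.of_nonneg hd) hd).1 x hx
  have h₂ : p b = p a + p (b - a) := by rw [← hp.1, add_sub_cancel]
  rw [h₂, LinearMap.add_apply]
  simpa using h₁

/-- If positive functionals vanish on the negative parts of positive multiples of positive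
elements, then a function which is additive on the positive cone and lies between zero and a
positive functional there extends to a linear functional. -/
lemma exists_linear_extension
    (hneg : ∀ c : E →ₗ[↥P] ℝ, fLE 0 c → ∀ μ : P, 0 < μ → ∀ x : E, 0 ≤ x →
      c (-(μ • x) ⊔ 0) ≤ 0)
    {c : E →ₗ[↥P] ℝ} (hc : fLE 0 c) (s : E → ℝ)
    (hadd : ∀ x y : E, 0 ≤ x → 0 ≤ y → s (x + y) = s x + s y)
    (hs : ∀ x : E, 0 ≤ x → 0 ≤ s x) (hsc : ∀ x : E, 0 ≤ x → s x ≤ c x) :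
    ∃ U : E →ₗ[↥P] ℝ, ∀ x : E, 0 ≤ x → U x = s x := by
  have key : ∀ a b x : E, 0 ≤ a → 0 ≤ b → x = a - b →
      s (x ⊔ 0) - s (-x ⊔ 0) = s a - s b := by
    intro a b x ha hb hx
    have hd : x ⊔ 0 - (-x ⊔ 0) = x := posPart_sub_negPart x
    have h₀ : x ⊔ 0 + b = a + (-x ⊔ 0) := by
      have h₁ : x ⊔ 0 = x + (-x ⊔ 0) := sub_eq_iff_eq_add.1 hd
      rw [h₁]
      nth_rewrite 1 [hx]
      abel
    have h₂ := hadd _ _ (le_sup_right : 0 ≤ x ⊔ 0) hb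
    have h₃ := hadd _ _ ha (le_sup_right : 0 ≤ -x ⊔ 0)
    rw [h₀] at h₂
    linarith
  have hdec : ∀ x : E, x = x ⊔ 0 - (-x ⊔ 0) := fun x => (posPart_sub_negPart x).symm
  let A : E →+ ℝ := AddMonoidHom.mk' (fun x => s (x ⊔ 0) - s (-x ⊔ 0)) <| by
    intro x y
    have h₁ := key (x ⊔ 0 + y ⊔ 0) ((-x ⊔ 0) + (-y ⊔ 0)) (x + y)
      (add_nonneg le_sup_right le_sup_right) (add_nonneg le_sup_right le_sup_right) (by
        conv_lhs => rw [hdec x, hdec y]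
        abel)
    rw [h₁, hadd _ _ le_sup_right le_sup_right, hadd _ _ le_sup_right le_sup_right]
    ring
  have hAdef : ∀ x, A x = s (x ⊔ 0) - s (-x ⊔ 0) := fun _ => rfl
  have hA : ∀ x : E, 0 ≤ x → A x = s x := by
    intro x hx
    have h₀ : s 0 = 0 := by
      have := hadd 0 0 le_rfl le_rfl
      rw [add_zero] at this
      linarith
    rw [hAdef, key x 0 x hx le_rfl (sub_zero x).symm, h₀, sub_zero]
  have hpos : ∀ μ : P, 0 ≤ μ → ∀ x : E, 0 ≤ x → 0 ≤ A (μ • x) := by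
    intro μ hμ x hx
    rcases hμ.eq_or_lt with rfl | hμ
    · simp
    · have h₁ := hneg c hc μ hμ x hx
      have h₂ := hsc (-(μ • x) ⊔ 0) le_sup_right
      have h₃ := hs (μ • x ⊔ 0) le_sup_right
      rw [hAdef]
      linarith
  have hrat : ∀ (q : ℚ) (x : E), A ((q : P) • x) = (q : ℝ) * A x := fun q x => by
    simpa using map_ratCast_smul A P ℝ q x
  have hcoe : ∀ q : ℚ, (((q : P)) : ℝ) = (q : ℝ) := fun q => by simp
  have hhom : ∀ (μ : P) (x : E), 0 ≤ x → A (μ • x) = (μ : ℝ) * A x := by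
    intro μ x hx
    have hAx : 0 ≤ A x := by rw [hA x hx]; exact hs x hx
    apply le_antisymm
    · refine le_of_forall_pos_le_add fun ε hε => ?_
      obtain ⟨q, hq₁, hq₂⟩ := exists_rat_btwn
        (show (μ : ℝ) < μ + ε / (A x + 1) by
          have : 0 < ε / (A x + 1) := by positivity
          linarith)
      have h₁ := hpos ((q : P) - μ) (by
        rw [sub_nonneg, ← Subtype.coe_le_coe, hcoe]; exact hq₁.le) x hx
      rw [sub_smul, map_sub, hrat] at h₁
      have h₂ : (q : ℝ) * A x ≤ (μ + ε / (A x + 1)) * A x :=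
        mul_le_mul_of_nonneg_right hq₂.le hAx
      have h₃ : ε / (A x + 1) * A x ≤ ε := by
        rw [div_mul_eq_mul_div, div_le_iff₀ (by positivity)]
        nlinarith
      linarith
    · refine le_of_forall_pos_le_add fun ε hε => ?_
      obtain ⟨q, hq₁, hq₂⟩ := exists_rat_btwn
        (show (μ : ℝ) - ε / (A x + 1) < μ by
          have : 0 < ε / (A x + 1) := by positivity
          linarith)
      have h₁ := hpos (μ - (q : P)) (by
        rw [sub_nonneg, ← Subtype.coe_le_coe, hcoe]; exact hq₂.le) x hx
      rw [sub_smul, map_sub, hrat] at h₁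
      have h₂ : (μ - ε / (A x + 1)) * A x ≤ (q : ℝ) * A x :=
        mul_le_mul_of_nonneg_right hq₁.le hAx
      have h₃ : ε / (A x + 1) * A x ≤ ε := by
        rw [div_mul_eq_mul_div, div_le_iff₀ (by positivity)]
        nlinarith
      linarith
  refine ⟨{ toFun := A, map_add' := A.map_add, map_smul' := fun μ x => ?_ }, hA⟩
  have h₁ := hhom μ _ (le_sup_right : 0 ≤ x ⊔ 0)
  have h₂ := hhom μ _ (le_sup_right : 0 ≤ -x ⊔ 0)
  have h₃ : A x = A (x ⊔ 0) - A (-x ⊔ 0) := by rw [← map_sub, ← hdec]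
  have h₄ : A (μ • x) = A (μ • (x ⊔ 0)) - A (μ • (-x ⊔ 0)) := by
    rw [← map_sub, ← smul_sub, ← hdec]
  rw [h₄, h₁, h₂, ← mul_sub, ← h₃]
  rfl

/-- The positive part of a difference of positive functionals, with the Riesz-Kantorovich
formula. -/
lemma exists_posPart
    (hneg : ∀ c : E →ₗ[↥P] ℝ, fLE 0 c → ∀ μ : P, 0 < μ → ∀ x : E, 0 ≤ x →
      c (-(μ • x) ⊔ 0) ≤ 0)
    {a b : E →ₗ[↥P] ℝ} (ha : fLE 0 a) (hb : fLE 0 b) :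
    ∃ U : E →ₗ[↥P] ℝ, fLE 0 U ∧ fLE (a - b) U ∧
      (∀ w : E →ₗ[↥P] ℝ, fLE 0 w → fLE (a - b) w → fLE U w) ∧
      ∀ x : E, 0 ≤ x → ∀ ε : ℝ, 0 < ε → ∃ y : E, 0 ≤ y ∧ y ≤ x ∧ U x < a y - b y + ε := by
  let S : E → Set ℝ := fun x => (fun y => a y - b y) '' Set.Icc 0 x
  have hub : ∀ w : E →ₗ[↥P] ℝ, fLE 0 w → fLE (a - b) w → ∀ x, ∀ r ∈ S x, r ≤ w x := by
    rintro w hw habw x _ ⟨y, ⟨hy₀, hyx⟩, rfl⟩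
    have h₁ := habw y hy₀
    have h₂ := hw (x - y) (sub_nonneg.2 hyx)
    simp only [LinearMap.zero_apply, LinearMap.sub_apply, map_sub] at h₁ h₂ ⊢
    linarith
  have haba : fLE (a - b) a := fun x hx => by
    have := hb x hx
    simp only [LinearMap.zero_apply, LinearMap.sub_apply] at this ⊢
    linarith
  have hbdd : ∀ x, BddAbove (S x) := fun x => ⟨a x, hub a ha haba x⟩
  have hzero : ∀ x, 0 ≤ x → (0 : ℝ) ∈ S x := fun x hx => ⟨0, ⟨le_rfl, hx⟩, by simp⟩
  have happrox : ∀ x : E, 0 ≤ x → ∀ ε : ℝ, 0 < ε →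
      ∃ y : E, 0 ≤ y ∧ y ≤ x ∧ sSup (S x) < a y - b y + ε := by
    intro x hx ε hε
    obtain ⟨_, ⟨y, hy, rfl⟩, hlt⟩ :=
      exists_lt_of_lt_csSup ⟨0, hzero x hx⟩ (sub_lt_self (sSup (S x)) hε)
    exact ⟨y, hy.1, hy.2, by linarith⟩
  obtain ⟨U, hU⟩ := exists_linear_extension hneg ha (fun x => sSup (S x)) (by
    intro x y hx hy
    apply le_antisymm
    · refine csSup_le ⟨0, hzero _ (add_nonneg hx hy)⟩ ?_
      rintro _ ⟨z, ⟨hz₀, hz⟩, rfl⟩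
      have h₁ : a (z ⊓ x) - b (z ⊓ x) ≤ sSup (S x) :=
        le_csSup (hbdd x) ⟨z ⊓ x, ⟨le_inf hz₀ hx, inf_le_right⟩, rfl⟩
      have h₂ : a (z - z ⊓ x) - b (z - z ⊓ x) ≤ sSup (S y) := by
        refine le_csSup (hbdd y) ⟨z - z ⊓ x, ⟨sub_nonneg.2 inf_le_left, ?_⟩, rfl⟩
        rw [sub_le_comm]
        exact le_inf (sub_le_self z hy) (sub_le_iff_le_add.2 hz)
      simp only [map_sub] at h₂ ⊢
      linarith
    · refine le_of_forall_pos_le_add fun ε hε => ?_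
      obtain ⟨u, hu₀, hu, hu'⟩ := happrox x hx (ε / 2) (half_pos hε)
      obtain ⟨v, hv₀, hv, hv'⟩ := happrox y hy (ε / 2) (half_pos hε)
      have h₁ : a (u + v) - b (u + v) ≤ sSup (S (x + y)) :=
        le_csSup (hbdd _) ⟨u + v, ⟨add_nonneg hu₀ hv₀, add_le_add hu hv⟩, rfl⟩
      simp only [map_add] at h₁
      linarith)
    (fun x hx => le_csSup (hbdd x) (hzero x hx))
    (fun x hx => csSup_le ⟨0, hzero x hx⟩ (hub a ha haba x))
  refine ⟨U, fun x hx => ?_, fun x hx => ?_, fun w hw habw x hx => ?_, fun x hx ε hε => ?_⟩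
  · rw [hU x hx]
    exact le_csSup (hbdd x) (hzero x hx)
  · rw [hU x hx]
    exact le_csSup (hbdd x) ⟨x, ⟨hx, le_rfl⟩, rfl⟩
  · rw [hU x hx]
    exact csSup_le ⟨0, hzero x hx⟩ (hub w hw habw x)
  · rw [hU x hx]
    exact happrox x hx ε hε

/-- If positive functionals `f` and `k` are disjoint, then a set generating the fragments of
`f + k` contains a projection nearly annihilating `f` and nearly fixing `k` at a given point. -/
lemma exists_proj_of_disjoint
    (hneg : ∀ c : E →ₗ[↥P] ℝ, fLE 0 c → ∀ μ : P, 0 < μ → ∀ x : E, 0 ≤ x →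
      c (-(μ • x) ⊔ 0) ≤ 0)
    {Ps : Set ((E →ₗ[↥P] ℝ) → (E →ₗ[↥P] ℝ))} (hPs : ∀ p ∈ Ps, IsBandProjF p)
    {f k : E →ₗ[↥P] ℝ} (hf : fLE 0 f) (hk : fLE 0 k)
    (hgen : ∀ x : E, IsLUB ((fun p => p (f + k) x) '' Ps) ((f + k) (x ⊔ 0)))
    (hdisj : ∀ w : E →ₗ[↥P] ℝ, OrderBoundedF w → fLE w k → fLE w f → fLE w 0)
    {x : E} (hx : 0 ≤ x) {η : ℝ} (hη : 0 < η) :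
    ∃ p ∈ Ps, p f x ≤ 5 * η ∧ k x ≤ p k x + 5 * η := by
  obtain ⟨V, hV₀, hV, hVle, hVapp⟩ := exists_posPart hneg hk hf
  have hVk : fLE V k := hVle k hk fun x hx => by
    have := hf x hx
    simp only [LinearMap.zero_apply, LinearMap.sub_apply] at this ⊢
    linarith
  have hkV : fLE (k - V) 0 := by
    refine hdisj _ (.of_nonneg fun x hx => ?_) (fun x hx => ?_) (fun x hx => ?_)
    · simpa using hVk x hx
    · simpa using hV₀ x hx
    · have := hV x hx
      simp only [LinearMap.sub_apply] at this ⊢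
      linarith
  obtain ⟨y, hy₀, hyx, hy⟩ := hVapp x hx η hη
  have hxy : 0 ≤ x - y := sub_nonneg.2 hyx
  have h₁ := hkV x hx
  have h₂ := hf y hy₀
  have h₃ := hk (x - y) hxy
  have hz := hgen (y - (x - y))
  obtain ⟨_, ⟨p, hp, rfl⟩, hlt, -⟩ := hz.exists_between (sub_lt_self _ hη)
  have hpp := hPs p hp
  have hz₀ := hk ((y - (x - y)) ⊔ 0 - (y - (x - y))) (sub_nonneg.2 le_sup_left)
  have hz₁ := hf ((y - (x - y)) ⊔ 0) le_sup_right
  have hpf := hpp.2.2.2.2 f (.of_nonneg hf) hf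
  have hpk := hpp.2.2.2.2 k (.of_nonneg hk) hk
  have h₄ := hpf.2 y hy₀
  have h₅ := hpf.1 x hx
  have h₆ := hpk.1 (x - y) hxy
  have h₇ := hpk.2 x hx
  refine ⟨p, hp, ?_⟩
  simp only [hpp.1, LinearMap.add_apply, LinearMap.zero_apply, LinearMap.sub_apply, map_sub] at *
  constructor <;> linarith

/-- The truncated remainders `(g - n f)⁺` decrease to a positive functional disjoint from `f`. -/
lemma exists_disjoint_remainder
    (hneg : ∀ c : E →ₗ[↥P] ℝ, fLE 0 c → ∀ μ : P, 0 < μ → ∀ x : E, 0 ≤ x →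
      c (-(μ • x) ⊔ 0) ≤ 0)
    {f g : E →ₗ[↥P] ℝ} (hf : fLE 0 f) (hg : fLE 0 g) :
    ∃ (G : ℕ → E →ₗ[↥P] ℝ) (h : E →ₗ[↥P] ℝ),
      (∀ n, fLE 0 (G n)) ∧ (∀ n, fLE (G n) g) ∧ (∀ n : ℕ, fLE (g - (n : ℝ) • f) (G n)) ∧
      (∀ x : E, 0 ≤ x → Filter.Tendsto (fun n => G n x) Filter.atTop (nhds (h x))) ∧
      fLE 0 h ∧ fLE h g ∧ InfZeroF h f := by
  have hnf : ∀ n : ℕ, fLE 0 ((n : ℝ) • f) := fun n x hx => by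
    simpa using mul_nonneg n.cast_nonneg (hf x hx)
  choose G hG₀ hG hGle _ using fun n : ℕ => exists_posPart hneg hg (hnf n)
  have hGg : ∀ n, fLE (G n) g := fun n => hGle n g hg fun x hx => by
    have := hnf n x hx
    simp only [LinearMap.zero_apply, LinearMap.sub_apply] at this ⊢
    linarith
  have hstep : ∀ w : E →ₗ[↥P] ℝ, fLE w f → ∀ n, fLE w (G n) → fLE (G (n + 1)) (G n - w) := by
    intro w hwf n hwG
    refine hGle (n + 1) _ (fun x hx => by simpa using hwG x hx) fun x hx => ?_
    have h₁ := hG n x hx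
    have h₂ := hwf x hx
    simp only [LinearMap.sub_apply, LinearMap.smul_apply, smul_eq_mul, Nat.cast_add,
      Nat.cast_one] at h₁ ⊢
    linarith
  have hanti : ∀ x : E, 0 ≤ x → Antitone fun n => G n x := fun x hx =>
    antitone_nat_of_succ_le fun n => by simpa using hstep 0 hf n (hG₀ n) x hx
  have hbdd : ∀ x : E, 0 ≤ x → BddBelow (Set.range fun n => G n x) := fun x hx =>
    ⟨0, by rintro _ ⟨n, rfl⟩; exact hG₀ n x hx⟩
  have hlim : ∀ x : E, 0 ≤ x →
      Filter.Tendsto (fun n => G n x) Filter.atTop (nhds (⨅ n, G n x)) := fun x hx =>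
    tendsto_atTop_ciInf (hanti x hx) (hbdd x hx)
  have h₀ : ∀ x : E, 0 ≤ x → 0 ≤ ⨅ n, G n x := fun x hx => le_ciInf fun n => hG₀ n x hx
  have h₁ : ∀ x : E, 0 ≤ x → ⨅ n, G n x ≤ g x := fun x hx =>
    (ciInf_le (hbdd x hx) 0).trans (hGg 0 x hx)
  obtain ⟨h, hh⟩ := exists_linear_extension hneg hg (fun x => ⨅ n, G n x) (by
    intro x y hx hy
    refine tendsto_nhds_unique (hlim _ (add_nonneg hx hy)) ?_
    simpa using (hlim x hx).add (hlim y hy)) h₀ h₁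
  have hh₀ : fLE 0 h := fun x hx => by rw [hh x hx]; exact h₀ x hx
  refine ⟨G, h, hG₀, hGg, hG, fun x hx => by rw [hh x hx]; exact hlim x hx, hh₀,
    fun x hx => by rw [hh x hx]; exact h₁ x hx, hh₀, hf, fun w _ hwh hwf x hx => ?_⟩
  have hwG : ∀ n, fLE w (G n) := fun n x hx =>
    (hwh x hx).trans (by rw [hh x hx]; exact ciInf_le (hbdd x hx) n)
  have hsum : ∀ n : ℕ, G n x + n * w x ≤ g x := by
    intro n
    induction n with
    | zero => simpa using hGg 0 x hx
    | succ n ih =>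
      have := hstep w hwf n (hwG n) x hx
      simp only [LinearMap.sub_apply, Nat.cast_add, Nat.cast_one] at this ⊢
      linarith
  by_contra! hlt
  obtain ⟨n, hn⟩ := exists_nat_gt (g x / w x)
  rw [LinearMap.zero_apply] at hlt
  rw [div_lt_iff₀ hlt] at hn
  have h₂ := hG₀ n x hx
  rw [LinearMap.zero_apply] at h₂
  linarith [hsum n]

end Helpers

theorem band_membership_iff_epsilon_delta
    [Lattice E] [AddCommGroup E] [Module P E]
    [CovariantClass E E (· + ·) (· ≤ ·)]
    (hdense : Dense (P : Set ℝ))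
    (hArch : ∀ x y : E, (∀ n : ℕ, n • x ≤ y) → x ≤ 0)
    (Ps : Set ((E →ₗ[↥P] ℝ) → (E →ₗ[↥P] ℝ))) (hPs : ∀ p ∈ Ps, IsBandProjF p)
    (hgen : ∀ f : E →ₗ[↥P] ℝ, OrderBoundedF f → fLE 0 f →
      ∀ x : E, IsLUB ((fun p => p f x) '' Ps) (f (x ⊔ 0)))
    (f g : E →ₗ[↥P] ℝ) (hf : OrderBoundedF f) (hg : OrderBoundedF g)
    (hfpos : fLE 0 f) (hgpos : fLE 0 g) :
    InBandF f g ↔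
    (∀ x : E, 0 ≤ x → ∀ ε : ℝ, 0 < ε → ∃ δ : ℝ, 0 < δ ∧
      ∀ p ∈ Ps, p f x ≤ δ → p g x ≤ ε) := by
  have : IsOrderedAddMonoid E :=
    { add_le_add_left := fun a b hab c => by
        rw [add_comm a, add_comm b]
        exact CovariantClass.elim c hab }
  have hneg : ∀ c : E →ₗ[↥P] ℝ, fLE 0 c → ∀ μ : P, 0 < μ → ∀ x : E, 0 ≤ x →
      c (-(μ • x) ⊔ 0) ≤ 0 := by
    intro c hc μ hμ x hx
    refine (hgen c (.of_nonneg hc) hc _).2 ?_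
    rintro _ ⟨p, hp, rfl⟩
    have h₁ := ((hPs p hp).2.2.2.2 c (.of_nonneg hc) hc).1 x hx
    have h₂ : (0 : ℝ) ≤ (μ : ℝ) * p c x := mul_nonneg hμ.le h₁
    simpa [Subfield.smul_def] using h₂
  constructor
  · intro hband x hx ε hε
    obtain ⟨G, h, hG₀, hGg, hG, hlim, hh₀, hhg, hhf⟩ :=
      exists_disjoint_remainder hneg hfpos hgpos
    obtain ⟨mg, mh, hmg, hmh, hinf⟩ := hband h (.of_nonneg hh₀)
      ⟨h, f, .of_nonneg hh₀, .of_nonneg hfpos, hhf⟩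
    have hh : h x ≤ 0 := hinf.2.2 h (.of_nonneg hh₀)
      (fun y hy => (hhg y hy).trans (hmg.2.1 g (by simp) y hy))
      (hmh.2.1 h (by simp)) x hx
    obtain ⟨n, hn⟩ := ((hlim x hx).eventually_lt_const
      (show h x < ε / 2 by linarith)).exists
    refine ⟨ε / (2 * (n + 1)), by positivity, fun p hp hpf => ?_⟩
    have hpp := hPs p hp
    have h₁ := (hpp.2.2.2.2 _ (.of_nonneg (hG₀ n)) (hG₀ n)).2 x hx
    have h₂ : p g x ≤ p (G n + (n : ℝ) • f) x := hpp.mono (fun y hy => by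
      have := hG n y hy
      simp only [LinearMap.sub_apply, LinearMap.add_apply] at this ⊢
      linarith) x hx
    rw [hpp.1, hpp.2.1, LinearMap.add_apply, LinearMap.smul_apply, smul_eq_mul] at h₂
    have h₃ : (n : ℝ) * p f x ≤ n * (ε / (2 * (n + 1))) :=
      mul_le_mul_of_nonneg_left hpf n.cast_nonneg
    have h₄ : (n : ℝ) * (ε / (2 * (n + 1))) ≤ ε / 2 := by
      rw [mul_div_assoc', div_le_div_iff₀ (by positivity) (by positivity)]
      nlinarith
    linarith
  · rintro hεδ h - ⟨mh, mf, hmh, hmf, hmh₀, -, hinf⟩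
    refine ⟨g, mh, .of_nonneg hgpos, hmh, hgpos, hmh₀, fun w _ hwg hwh => ?_⟩
    obtain ⟨k, hk₀, hwk, hkle, -⟩ := exists_posPart hneg hgpos
      (b := g - w) (fun x hx => by simpa using hwg x hx)
    rw [sub_sub_cancel] at hwk hkle
    have hkg := hkle g hgpos hwg
    have hkh := hkle mh hmh₀ hwh
    intro x hx
    refine (hwk x hx).trans (le_of_forall_pos_le_add fun ε hε => ?_)
    obtain ⟨δ, hδ, hδε⟩ := hεδ x hx (ε / 2) (half_pos hε)
    have hfk : fLE 0 (f + k) := fun x hx => by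
      simpa using add_nonneg (hfpos x hx) (hk₀ x hx)
    have hη : 0 < min δ (ε / 2) / 5 := by positivity
    obtain ⟨p, hp, hpf, hpk⟩ := exists_proj_of_disjoint hneg hPs hfpos hk₀
      (hgen _ (.of_nonneg hfk) hfk)
      (fun u hu huk huf => hinf u hu (fun y hy => (huk y hy).trans (hkh y hy))
        (fun y hy => (huf y hy).trans (hmf.2.1 f (by simp) y hy))) hx hη
    have h₁ := hδε p hp (by linarith [min_le_left δ (ε / 2)])
    have h₂ := (hPs p hp).mono hkg x hx
    rw [LinearMap.zero_apply]
    linarith [min_le_right δ (ε / 2)]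
end

section
/- Let ℙ be a dense subfield of ℝ, E a vector lattice over ℙ, E~ the Dedekind complete vector lattice of order bounded ℙ-linear functionals from E to ℝ, and 𝒫 a generating set of band projections on E~. Then for positive functionals f, g ∈ E~ and every x ∈ E₊, the band projection π_f of E~ onto {f}^⊥⊥ satisfies the representation: π_f g(x) = sup_{ε>0} inf{(pg)(x) : p ∈ 𝒫, (p^⊥ f)(x) ≤ ε}, where p^⊥ denotes the complementary band projection of p. -/
/-! Statement 13: For a generating set `𝒫` of band projections on `E~` and positive
functionals `f, g ∈ E~`, the band projection `π_f` onto `{f}^⊥⊥` satisfies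
`π_f g (x) = sup_{ε>0} inf{(pg)(x) : p ∈ 𝒫, (p^⊥ f)(x) ≤ ε}` for every `x ∈ E₊`.
Here `π_f g` is characterized as the (unique) functional `h` with `0 ≤ h ≤ g`,
`h ∈ {f}^⊥⊥` and `g − h ⊥ f`, and `(p^⊥ f)(x) = f x − (pf)(x)`. -/

universe u

variable {P : Subfield ℝ} {E : Type u}

section LatticeGroup

variable {G : Type*} [Lattice G] [AddCommGroup G] [IsOrderedAddMonoid G]

/-- A monotone additive function on a subfield of `ℝ` is multiplication by a constant. -/
lemma Subfield.addMonoidHom_eq_mul_of_nonneg (φ : P →+ ℝ)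
    (hφ : ∀ c : P, 0 ≤ (c : ℝ) → 0 ≤ φ c) (c : P) : φ c = c * φ 1 := by
  have h1 : 0 ≤ φ 1 := hφ 1 (by simp)
  have hint : ∀ k : ℤ, φ (k : P) = k * φ 1 := fun k => by
    have := map_zsmul φ k 1
    simpa using this
  have hbound : ∀ n : ℕ, |(n : ℝ) * (φ c - c * φ 1)| ≤ φ 1 := by
    intro n
    have hn : φ ((n : P) * c) = n * φ c := by
      have := map_nsmul φ n c
      simpa using this
    have hfloor := Int.floor_le ((n : ℝ) * c)
    have hlt := Int.lt_floor_add_one ((n : ℝ) * c)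
    set k : ℤ := ⌊(n : ℝ) * c⌋
    have hlo := hφ ((n : P) * c - (k : P)) (by push_cast; linarith)
    have hhi := hφ (((k + 1 : ℤ) : P) - (n : P) * c) (by push_cast; linarith)
    rw [map_sub, hn, hint] at hlo hhi
    push_cast at hhi
    rw [abs_le]
    constructor <;> nlinarith
  by_contra hne
  have hpos : 0 < |φ c - c * φ 1| := abs_pos.mpr (sub_ne_zero.mpr hne)
  obtain ⟨n, hn⟩ := exists_nat_gt (φ 1 / |φ c - c * φ 1|)
  have := hbound n
  rw [abs_mul, Nat.abs_cast] at this
  rw [div_lt_iff₀ hpos] at hn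
  linarith

/-- An additive function on the positive cone of a lattice ordered group extends to the group. -/
lemma exists_addMonoidHom_extension (m : G → ℝ)
    (hm : ∀ a b : G, 0 ≤ a → 0 ≤ b → m (a + b) = m a + m b) :
    ∃ M : G →+ ℝ, ∀ x : G, 0 ≤ x → M x = m x := by
  have h0 : m 0 = 0 := by
    have := hm 0 0 le_rfl le_rfl
    rw [add_zero] at this
    linarith
  refine ⟨AddMonoidHom.mk' (fun x => m x⁺ - m x⁻) ?_, ?_⟩
  · intro a b
    have key : (a + b)⁺ + (a⁻ + b⁻) = (a + b)⁻ + (a⁺ + b⁺) := by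
      have h : (a + b)⁺ - (a + b)⁻ = (a⁺ - a⁻) + (b⁺ - b⁻) := by simp only [posPart_sub_negPart]
      rw [sub_eq_iff_eq_add] at h
      rw [h]
      abel
    have := congrArg m key
    rw [hm _ _ (posPart_nonneg _) (add_nonneg (negPart_nonneg _) (negPart_nonneg _)),
      hm _ _ (negPart_nonneg _) (add_nonneg (posPart_nonneg _) (posPart_nonneg _)),
      hm _ _ (negPart_nonneg _) (negPart_nonneg _),
      hm _ _ (posPart_nonneg _) (posPart_nonneg _)] at this
    linarith
  · intro x hx
    simp [posPart_of_nonneg hx, negPart_of_nonneg hx, h0]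

/-- The Riesz–Kantorovich infimum of two positive additive functionals. -/
lemma exists_inf_addMonoidHom (f k : G →+ ℝ) (hf : ∀ x, 0 ≤ x → 0 ≤ f x)
    (hk : ∀ x, 0 ≤ x → 0 ≤ k x) :
    ∃ M : G →+ ℝ, ∀ x, 0 ≤ x →
      IsGLB {r : ℝ | ∃ y, 0 ≤ y ∧ y ≤ x ∧ r = f (x - y) + k y} (M x) := by
  set S : G → Set ℝ := fun x => {r : ℝ | ∃ y, 0 ≤ y ∧ y ≤ x ∧ r = f (x - y) + k y} with hS
  have hglb : ∀ x, 0 ≤ x → IsGLB (S x) (sInf (S x)) := by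
    intro x hx
    refine isGLB_csInf ⟨_, 0, le_rfl, hx, rfl⟩ ⟨0, ?_⟩
    rintro r ⟨y, hy0, hyx, rfl⟩
    exact add_nonneg (hf _ (sub_nonneg.mpr hyx)) (hk _ hy0)
  obtain ⟨M, hM⟩ := exists_addMonoidHom_extension (fun x => sInf (S x)) (by
    intro a b ha hb
    refine (hglb _ (add_nonneg ha hb)).unique ⟨?_, ?_⟩
    · rintro r ⟨y, hy0, hyx, rfl⟩
      have h1 := (hglb a ha).1 ⟨y ⊓ a, le_inf hy0 ha, inf_le_right, rfl⟩
      have hle : y - y ⊓ a ≤ b := by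
        rw [sub_le_iff_le_add, add_inf]
        exact le_inf (le_add_of_nonneg_left hb) (by rwa [add_comm])
      have h2 := (hglb b hb).1 ⟨y - y ⊓ a, sub_nonneg.mpr inf_le_left, hle, rfl⟩
      have e : f (a + b - y) + k y
          = (f (a - y ⊓ a) + k (y ⊓ a)) + (f (b - (y - y ⊓ a)) + k (y - y ⊓ a)) := by
        simp only [map_sub, map_add]
        ring
      rw [e]
      exact add_le_add h1 h2
    · intro r hr
      have h1 : r - sInf (S a) ≤ sInf (S b) := by
        refine (hglb b hb).2 ?_
        rintro _ ⟨z, hz0, hzb, rfl⟩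
        have h2 : r - (f (b - z) + k z) ≤ sInf (S a) := by
          refine (hglb a ha).2 ?_
          rintro _ ⟨y, hy0, hya, rfl⟩
          have := hr ⟨y + z, add_nonneg hy0 hz0, add_le_add hya hzb, rfl⟩
          simp only [map_sub, map_add] at this ⊢
          linarith
        linarith
      linarith)
  exact ⟨M, fun x hx => by rw [hM x hx]; exact hglb x hx⟩

end LatticeGroup

section OrderDual

variable [Lattice E] [AddCommGroup E] [Module P E]

lemma fLE.neg_le {f : E →ₗ[P] ℝ} (hf : fLE 0 f) : fLE (-f) f := fun x hx => by
  have := hf x hx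
  simp only [LinearMap.zero_apply, LinearMap.neg_apply] at *
  linarith

lemma IsBandProjF.map_sub {p : (E →ₗ[P] ℝ) → (E →ₗ[P] ℝ)} (hp : IsBandProjF p)
    (f g : E →ₗ[P] ℝ) : p (f - g) = p f - p g := by
  rw [eq_sub_iff_add_eq, ← hp.1, sub_add_cancel]

variable [IsOrderedAddMonoid E]

lemma fLE.monotone {f : E →ₗ[P] ℝ} (hf : fLE 0 f) {x y : E} (hxy : x ≤ y) : f x ≤ f y := by
  have := hf (y - x) (sub_nonneg.mpr hxy)
  rw [map_sub] at this
  simpa using this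

lemma fLE.orderBoundedF {f : E →ₗ[P] ℝ} (hf : fLE 0 f) : OrderBoundedF f :=
  fun a b => ⟨f a, f b, fun _ ha hb => ⟨hf.monotone ha, hf.monotone hb⟩⟩

lemma fLE.antisymm {f g : E →ₗ[P] ℝ} (hfg : fLE f g) (hgf : fLE g f) : f = g := by
  ext x
  rw [← posPart_sub_negPart x, map_sub, map_sub,
    le_antisymm (hfg _ (posPart_nonneg x)) (hgf _ (posPart_nonneg x)),
    le_antisymm (hfg _ (negPart_nonneg x)) (hgf _ (negPart_nonneg x))]

lemma fLE.isModF {f : E →ₗ[P] ℝ} (hf : fLE 0 f) : IsModF f f := by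
  refine ⟨hf.orderBoundedF, ?_, fun w _ hw => hw f (by simp)⟩
  rintro a (rfl | rfl)
  · exact fun _ _ => le_rfl
  · exact hf.neg_le

lemma IsModF.eq_of_nonneg {f m : E →ₗ[P] ℝ} (hm : IsModF f m) (hf : fLE 0 f) : m = f :=
  fLE.antisymm (hm.2.2 f hf.orderBoundedF hf.isModF.2.1) (hm.2.1 f (by simp))

lemma disjointF_iff_infZeroF {f g : E →ₗ[P] ℝ} (hf : fLE 0 f) (hg : fLE 0 g) :
    DisjointF f g ↔ InfZeroF f g := by
  constructor
  · rintro ⟨mu, mv, hmu, hmv, hinf⟩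
    rwa [hmu.eq_of_nonneg hf, hmv.eq_of_nonneg hg] at hinf
  · exact fun h => ⟨f, g, hf.isModF, hg.isModF, h⟩

/-- The infimum of positive functionals exists and is given by the Riesz–Kantorovich formula, as
soon as one of them vanishes on the negative part of every nonnegative multiple of a positive
element. -/
lemma exists_inf_linearMap {f k : E →ₗ[P] ℝ} (hf : fLE 0 f) (hk : fLE 0 k)
    (hsc : ∀ c : P, 0 ≤ (c : ℝ) → ∀ x : E, 0 ≤ x → f (-(c • x) ⊔ 0) ≤ 0) :
    ∃ M : E →ₗ[P] ℝ, fLE 0 M ∧ fLE M f ∧ fLE M k ∧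
      (∀ w : E →ₗ[P] ℝ, fLE w f → fLE w k → fLE w M) ∧
      ∀ x : E, 0 ≤ x → ∀ η : ℝ, 0 < η → ∃ y, 0 ≤ y ∧ y ≤ x ∧ f (x - y) + k y < M x + η := by
  obtain ⟨M, hM⟩ := exists_inf_addMonoidHom f.toAddMonoidHom k.toAddMonoidHom hf hk
  simp only [LinearMap.toAddMonoidHom_coe] at hM
  have hM0 : ∀ x, 0 ≤ x → 0 ≤ M x := by
    intro x hx
    refine (hM x hx).2 ?_
    rintro r ⟨y, hy0, hyx, rfl⟩
    exact add_nonneg (hf _ (sub_nonneg.mpr hyx)) (hk _ hy0)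
  have hMf : ∀ x, 0 ≤ x → M x ≤ f x := fun x hx =>
    (hM x hx).1 ⟨0, le_rfl, hx, by simp⟩
  have hMk : ∀ x, 0 ≤ x → M x ≤ k x := fun x hx =>
    (hM x hx).1 ⟨x, hx, le_rfl, by simp⟩
  have hpos : ∀ x, 0 ≤ x → ∀ c : P, M (c • x) = c * M x := by
    intro x hx c
    have := Subfield.addMonoidHom_eq_mul_of_nonneg
      (M.comp (AddMonoidHom.flip (smulAddHom P E) x)) (by
        intro c hc
        change 0 ≤ M (c • x)
        rw [← posPart_sub_negPart (c • x), map_sub]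
        have h1 := hM0 _ (posPart_nonneg (c • x))
        have h2 := hMf _ (negPart_nonneg (c • x))
        have h3 := hsc c hc x hx
        rw [← negPart_def] at h3
        linarith) c
    simpa using this
  refine ⟨{ M with
    map_smul' := fun c x => ?_ }, hM0, hMf, hMk, ?_, ?_⟩
  · change M (c • x) = c • M x
    rw [← posPart_sub_negPart x, smul_sub, map_sub, map_sub, hpos _ (posPart_nonneg x),
      hpos _ (negPart_nonneg x), smul_sub]
    rfl
  · intro w hwf hwk x hx
    refine (hM x hx).2 ?_
    rintro r ⟨y, hy0, hyx, rfl⟩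
    have h1 := hwf _ (sub_nonneg.mpr hyx)
    have h2 := hwk _ hy0
    rw [map_sub] at h1
    linarith
  · intro x hx η hη
    obtain ⟨r, ⟨y, hy0, hyx, rfl⟩, -, hr⟩ := (hM x hx).exists_between (lt_add_of_pos_right _ hη)
    exact ⟨y, hy0, hyx, hr⟩

/-- A monotone sequence of functionals which is bounded above converges pointwise. -/
lemma exists_tendsto_linearMap {m : ℕ → E →ₗ[P] ℝ} {h : E →ₗ[P] ℝ}
    (hmono : ∀ n, fLE (m n) (m (n + 1))) (hle : ∀ n, fLE (m n) h) :
    ∃ s : E →ₗ[P] ℝ, ∀ x, Filter.Tendsto (fun n => m n x) Filter.atTop (nhds (s x)) := by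
  have hpos : ∀ x, 0 ≤ x → ∃ l, Filter.Tendsto (fun n => m n x) Filter.atTop (nhds l) :=
    fun x hx => ⟨_, tendsto_atTop_ciSup (monotone_nat_of_le_succ fun n => hmono n x hx)
      ⟨h x, by rintro _ ⟨n, rfl⟩; exact hle n x hx⟩⟩
  have hall : ∀ x, ∃ l, Filter.Tendsto (fun n => m n x) Filter.atTop (nhds l) := by
    intro x
    obtain ⟨a, ha⟩ := hpos _ (posPart_nonneg x)
    obtain ⟨b, hb⟩ := hpos _ (negPart_nonneg x)
    refine ⟨a - b, (ha.sub hb).congr fun n => ?_⟩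
    rw [← map_sub, posPart_sub_negPart]
  choose s hs using hall
  refine ⟨{ toFun := s, map_add' := fun x y => ?_, map_smul' := fun c x => ?_ }, hs⟩
  · exact tendsto_nhds_unique (hs (x + y)) (((hs x).add (hs y)).congr fun n => by simp)
  · refine tendsto_nhds_unique (hs (c • x)) (((hs x).const_mul (c : ℝ)).congr fun n => ?_)
    rw [map_smul]
    rfl

/-- A positive functional `h` in the band generated by `f` is pointwise approximated on the
positive cone by functionals below both `h` and a multiple of `f`. -/
lemma InBandF.exists_approx {f h : E →ₗ[P] ℝ} (hf : fLE 0 f) (hh : fLE 0 h)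
    (hband : InBandF f h)
    (hsc : ∀ c : P, 0 ≤ (c : ℝ) → ∀ x : E, 0 ≤ x → h (-(c • x) ⊔ 0) ≤ 0)
    {x : E} (hx : 0 ≤ x) {δ : ℝ} (hδ : 0 < δ) :
    ∃ (n : ℕ) (m : E →ₗ[P] ℝ), fLE 0 m ∧ fLE m h ∧ fLE m ((n : ℝ) • f) ∧ h x - δ < m x := by
  have hnf : ∀ n : ℕ, fLE 0 ((n : ℝ) • f) := fun n y hy =>
    mul_nonneg (Nat.cast_nonneg n) (hf y hy)
  choose m hm0 hmh hmf hmglb _ using fun n : ℕ => exists_inf_linearMap hh (hnf n) hsc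
  have hmono : ∀ n, fLE (m n) (m (n + 1)) := fun n => by
    refine hmglb (n + 1) _ (hmh n) fun y hy => (hmf n y hy).trans ?_
    have := hf y hy
    simp only [LinearMap.smul_apply, LinearMap.zero_apply, smul_eq_mul] at *
    push_cast
    nlinarith
  obtain ⟨s, hs⟩ := exists_tendsto_linearMap hmono hmh
  have hms : ∀ n, fLE (m n) s := fun n y hy =>
    (monotone_nat_of_le_succ fun n => hmono n y hy).ge_of_tendsto (hs y) n
  have hsh : fLE 0 (h - s) := fun y hy =>
    sub_nonneg.mpr (le_of_tendsto' (hs y) fun n => hmh n y hy)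
  have hdisj : InfZeroF (h - s) f := by
    refine ⟨hsh, hf, fun w _ hwd hwf => ?_⟩
    have hstep : ∀ n, fLE (w + m n) s := fun n => by
      have hle : fLE (w + m n) (m (n + 1)) := by
        refine hmglb (n + 1) _ (fun y hy => ?_) (fun y hy => ?_)
        · have h1 := hwd y hy
          have h2 := hms n y hy
          simp only [LinearMap.sub_apply, LinearMap.add_apply] at *
          linarith
        · have h1 := hwf y hy
          have h2 := hmf n y hy
          simp only [LinearMap.smul_apply, LinearMap.add_apply, smul_eq_mul] at *
          push_cast
          linarith
      exact fun y hy => (hle y hy).trans (hms (n + 1) y hy)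
    intro y hy
    have := le_of_tendsto' ((hs y).const_add (w y)) fun n => hstep n y hy
    simpa using this
  have hd := hband (h - s) hsh.orderBoundedF ((disjointF_iff_infZeroF hsh hf).mpr hdisj)
  have hle := ((disjointF_iff_infZeroF hh hsh).mp hd).2.2 (h - s) hsh.orderBoundedF
    (fun y hy => by
      have := (hm0 0 y hy).trans (hms 0 y hy)
      simp only [LinearMap.sub_apply, LinearMap.zero_apply] at *
      linarith) (fun _ _ => le_rfl) x hx
  simp only [LinearMap.sub_apply, LinearMap.zero_apply] at hle
  obtain ⟨n, hn⟩ := ((hs x).eventually (lt_mem_nhds (show h x - δ < s x by linarith))).exists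
  exact ⟨n, m n, hm0 n, hmh n, hmf n, hn⟩

lemma IsBandProjF.nonneg {p : (E →ₗ[P] ℝ) → (E →ₗ[P] ℝ)} (hp : IsBandProjF p)
    {f : E →ₗ[P] ℝ} (hf : fLE 0 f) : fLE 0 (p f) :=
  (hp.2.2.2.2 f hf.orderBoundedF hf).1

lemma IsBandProjF.le_self {p : (E →ₗ[P] ℝ) → (E →ₗ[P] ℝ)} (hp : IsBandProjF p)
    {f : E →ₗ[P] ℝ} (hf : fLE 0 f) : fLE (p f) f :=
  (hp.2.2.2.2 f hf.orderBoundedF hf).2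

lemma IsBandProjF.compl_nonneg {p : (E →ₗ[P] ℝ) → (E →ₗ[P] ℝ)} (hp : IsBandProjF p)
    {f : E →ₗ[P] ℝ} (hf : fLE 0 f) : fLE 0 (f - p f) := fun x hx =>
  sub_nonneg.mpr (hp.le_self hf x hx)

/-- A generating set separates disjoint positive functionals approximately at each positive
element. -/
lemma exists_bandProjF_separating {Ps : Set ((E →ₗ[P] ℝ) → (E →ₗ[P] ℝ))}
    (hPs : ∀ p ∈ Ps, IsBandProjF p) {f k : E →ₗ[P] ℝ} (hf : fLE 0 f) (hk : fLE 0 k)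
    (hgen : ∀ x : E, IsLUB ((fun p => p (f + k) x) '' Ps) ((f + k) (x ⊔ 0)))
    {x y : E} (hy : 0 ≤ y) (hyx : y ≤ x) {η : ℝ} (hη : 0 < η) (hfy : f (x - y) ≤ η)
    (hky : k y ≤ η) :
    ∃ p ∈ Ps, f x - p f x ≤ 3 * η ∧ p k x ≤ 3 * η := by
  set z := y - (x - y) with hz
  obtain ⟨_, ⟨p, hp, rfl⟩, hlt, -⟩ := (hgen z).exists_between (sub_lt_self _ hη)
  have hb := hPs p hp
  refine ⟨p, hp, ?_⟩
  have hxy : 0 ≤ x - y := sub_nonneg.mpr hyx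
  have hyz : y ≤ z⁺ + (x - y) := sub_le_iff_le_add.mp (le_posPart z)
  have hxz : x - y ≤ z⁻ + y := by
    refine sub_le_iff_le_add.mp ?_
    rw [← neg_sub]
    exact neg_le_negPart z
  have hzp := hb.1 f k
  have hzz : p (f + k) z = p f z⁺ + p k z⁺ - (p f z⁻ + p k z⁻) := by
    rw [← LinearMap.add_apply, ← LinearMap.add_apply, ← hzp, ← _root_.map_sub,
      posPart_sub_negPart]
  simp only [← posPart_def, hzz, LinearMap.add_apply] at hlt
  have a1 := hb.le_self hf z⁺ (posPart_nonneg z)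
  have a2 := hb.le_self hk z⁺ (posPart_nonneg z)
  have a3 := hb.nonneg hf z⁻ (negPart_nonneg z)
  have a4 := hb.nonneg hk z⁻ (negPart_nonneg z)
  have b1 := (hb.compl_nonneg hf).monotone hyz
  have b2 := (hb.nonneg hk).monotone hxz
  have b3 := hb.nonneg hf (x - y) hxy
  have b4 := hb.le_self hk y hy
  simp only [_root_.map_sub, _root_.map_add, LinearMap.sub_apply, LinearMap.zero_apply] at *
  constructor <;> linarith

end OrderDual

theorem principal_band_projection_representation
    [Lattice E] [AddCommGroup E] [Module P E]
    [CovariantClass E E (· + ·) (· ≤ ·)]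
    (hdense : Dense (P : Set ℝ))
    (hArch : ∀ x y : E, (∀ n : ℕ, n • x ≤ y) → x ≤ 0)
    (Ps : Set ((E →ₗ[↥P] ℝ) → (E →ₗ[↥P] ℝ))) (hPs : ∀ p ∈ Ps, IsBandProjF p)
    (hgen : ∀ f : E →ₗ[↥P] ℝ, OrderBoundedF f → fLE 0 f →
      ∀ x : E, IsLUB ((fun p => p f x) '' Ps) (f (x ⊔ 0)))
    (f g : E →ₗ[↥P] ℝ) (hf : OrderBoundedF f) (hg : OrderBoundedF g)
    (hfpos : fLE 0 f) (hgpos : fLE 0 g)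
    -- `h = π_f g`: the component of `g` in the band `{f}^⊥⊥`
    (h : E →ₗ[↥P] ℝ) (hh : OrderBoundedF h) (hhpos : fLE 0 h) (hhle : fLE h g)
    (hhband : InBandF f h) (hhdisj : DisjointF (g - h) f) :
    ∀ x : E, 0 ≤ x →
      h x = sSup {r : ℝ | ∃ ε : ℝ, 0 < ε ∧
        r = sInf {s : ℝ | ∃ p ∈ Ps, f x - p f x ≤ ε ∧ s = p g x}} := by
  intro x hx
  have : IsOrderedAddMonoid E :=
    { add_le_add_left := fun a b hab c => by
        rw [add_comm a c, add_comm b c]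
        exact CovariantClass.elim c hab }
  have hsc : ∀ u : E →ₗ[↥P] ℝ, fLE 0 u → ∀ c : P, 0 ≤ (c : ℝ) → ∀ x : E, 0 ≤ x →
      u (-(c • x) ⊔ 0) ≤ 0 := by
    intro u hu c hc x hx
    refine (hgen u hu.orderBoundedF hu (-(c • x))).2 ?_
    rintro _ ⟨p, hp, rfl⟩
    have h1 : 0 ≤ (c : ℝ) * p u x := mul_nonneg hc ((hPs p hp).nonneg hu x hx)
    have h2 : p u (c • x) = (c : ℝ) * p u x := map_smul (p u) c x
    simp only [map_neg, h2]
    linarith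
  have hk : fLE 0 (g - h) := fun y hy => sub_nonneg.mpr (hhle y hy)
  have hinf := (disjointF_iff_infZeroF hk hfpos).mp hhdisj
  have hsep : ∀ ε : ℝ, 0 < ε → ∀ δ : ℝ, 0 < δ →
      ∃ p ∈ Ps, f x - p f x ≤ ε ∧ p g x ≤ h x + δ := by
    intro ε hε δ hδ
    obtain ⟨M, hM0, hMf, hMk, -, hMx⟩ := exists_inf_linearMap hfpos hk (hsc f hfpos)
    set η := min ε δ / 3 with hη
    have hη0 : 0 < η := div_pos (lt_min hε hδ) (by norm_num)
    obtain ⟨y, hy0, hyx, hlt⟩ := hMx x hx η hη0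
    have hMz := hinf.2.2 M hM0.orderBoundedF hMk hMf x hx
    have h1 := hfpos _ (sub_nonneg.mpr hyx)
    have h2 := hk y hy0
    have hfk : fLE 0 (f + (g - h)) := fun y hy => add_nonneg (hfpos y hy) (hk y hy)
    simp only [LinearMap.zero_apply] at h1 h2 hMz
    obtain ⟨p, hp, hpf, hpk⟩ := exists_bandProjF_separating hPs hfpos hk
      (hgen _ hfk.orderBoundedF hfk) hy0 hyx hη0 (by linarith) (by linarith)
    have hmin1 := min_le_left ε δ
    have hmin2 := min_le_right ε δ
    have hph := (hPs p hp).le_self hhpos x hx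
    rw [(hPs p hp).map_sub, LinearMap.sub_apply] at hpk
    exact ⟨p, hp, by linarith, by linarith⟩
  have hbdd : ∀ ε : ℝ, BddBelow {s : ℝ | ∃ p ∈ Ps, f x - p f x ≤ ε ∧ s = p g x} := by
    refine fun ε => ⟨0, ?_⟩
    rintro _ ⟨p, hp, -, rfl⟩
    exact (hPs p hp).nonneg hgpos x hx
  symm
  refine IsLUB.csSup_eq ⟨?_, ?_⟩ ⟨_, 1, one_pos, rfl⟩
  · rintro _ ⟨ε, hε, rfl⟩
    refine le_of_forall_pos_le_add fun δ hδ => ?_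
    obtain ⟨p, hp, hpf, hpg⟩ := hsep ε hε δ hδ
    exact (csInf_le (hbdd ε) ⟨p, hp, hpf, rfl⟩).trans hpg
  · intro b hb
    refine le_of_forall_pos_le_add fun δ hδ => ?_
    obtain ⟨n, m, hm0, hmh, hmf, hmx⟩ := hhband.exists_approx hfpos hhpos (hsc h hhpos) hx
      (half_pos hδ)
    have hn : (0 : ℝ) < n + 1 := by positivity
    set ε := δ / 2 / (n + 1) with hε
    have hε0 : 0 < ε := div_pos (half_pos hδ) hn
    have hεn : ε * (n + 1) = δ / 2 := div_mul_cancel₀ _ hn.ne'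
    have hbε := hb ⟨ε, hε0, rfl⟩
    obtain ⟨q, hq, hqf, -⟩ := hsep ε hε0 1 one_pos
    have hle : h x - δ ≤ sInf {s : ℝ | ∃ p ∈ Ps, f x - p f x ≤ ε ∧ s = p g x} := by
      refine le_csInf ⟨_, q, hq, hqf, rfl⟩ ?_
      rintro _ ⟨p, hp, hpf, rfl⟩
      have hb := hPs p hp
      have hnm : fLE 0 ((n : ℝ) • f - m) := fun y hy => sub_nonneg.mpr (hmf y hy)
      have hhm : fLE 0 (h - m) := fun y hy => sub_nonneg.mpr (hmh y hy)
      have h1 := hb.nonneg hk x hx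
      have h2 := hb.nonneg hhm x hx
      have h3 := hb.le_self hnm x hx
      have h4 := mul_le_mul_of_nonneg_left hpf (Nat.cast_nonneg (α := ℝ) n)
      simp only [hb.map_sub, hb.2.1, LinearMap.sub_apply, LinearMap.smul_apply, smul_eq_mul,
        LinearMap.zero_apply] at h1 h2 h3
      nlinarith
    linarith
end

section
/- Let E be a vector lattice with the projection property, X a real vector space, and ⟦·⟧ : X → E₊ a map such that: ⟦x⟧ = 0 iff x = 0; ⟦λx⟧ = |λ|⟦x⟧ for all λ ∈ ℝ, x ∈ X; ⟦x + y⟧ ≤ ⟦x⟧ + ⟦y⟧; and the norm is d-decomposable, i.e. whenever ⟦x⟧ = e₁ + e₂ with e₁, e₂ ∈ E₊ disjoint, there exist x₁, x₂ ∈ X with x = x₁ + x₂ and ⟦x_k⟧ = e_k (k = 1, 2). Assume E = (⟦X⟧)^⊥⊥, where ⟦X⟧ := {⟦x⟧ : x ∈ X}. Then there exist a complete Boolean algebra ℬ of commuting idempotent linear operators on X and a Boolean isomorphism h from the Boolean algebra 𝔓(E) of band projections of E onto ℬ such that b⟦x⟧ = ⟦h(b)x⟧ for all b ∈ 𝔓(E)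 and x ∈ X. -/
/-! Statement 17: If `(X, ⟦·⟧, E)` is a d-decomposable lattice-normed space over a vector
lattice `E` with the projection property and `E = ⟦X⟧^⊥⊥`, then there exist a complete
Boolean algebra `ℬ` of commuting idempotent linear operators on `X` and a Boolean
isomorphism `h` of `𝔓(E)` onto `ℬ` with `b⟦x⟧ = ⟦h(b)x⟧` for all band projections `b`
and `x ∈ X`. -/

universe u v

variable {E : Type u} {X : Type v}

/-- A band projection on `E`. -/
def IsBandProjection [Lattice E] [AddCommGroup E] [Module ℝ E] (π : E →ₗ[ℝ] E) : Prop :=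
  π.comp π = π ∧ ∀ x : E, 0 ≤ x → 0 ≤ π x ∧ π x ≤ x

/-- The disjoint complement of a set. -/
def disjComplement [Lattice E] [AddCommGroup E] (M : Set E) : Set E :=
  {x | ∀ y ∈ M, |x| ⊓ |y| = 0}

/-- A band of `E`. -/
def IsBand [Lattice E] [AddCommGroup E] (B : Set E) : Prop :=
  ∃ M : Set E, M.Nonempty ∧ B = disjComplement M

namespace IsBandProjection

theorem sup_eq [AddCommGroup E] [Module ℝ E] (π ρ : E →ₗ[ℝ] E) : π + ρ - π.comp ρ =
    LinearMap.id - (LinearMap.id - π).comp (LinearMap.id - ρ) := by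
  ext x
  simp
  abel

variable [Lattice E] [AddCommGroup E] [Module ℝ E] {π ρ : E →ₗ[ℝ] E}

theorem idem (h : IsBandProjection π) (x : E) : π (π x) = π x :=
  LinearMap.congr_fun h.1 x

theorem nonneg (h : IsBandProjection π) {x : E} (hx : 0 ≤ x) : 0 ≤ π x := (h.2 x hx).1

theorem le_self (h : IsBandProjection π) {x : E} (hx : 0 ≤ x) : π x ≤ x := (h.2 x hx).2

theorem zero : IsBandProjection (0 : E →ₗ[ℝ] E) := ⟨by simp, fun x hx => by simp [hx]⟩

variable [IsOrderedAddMonoid E]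

theorem mono (h : IsBandProjection π) {x y : E} (hxy : x ≤ y) : π x ≤ π y := by
  have := h.nonneg (sub_nonneg.2 hxy)
  rwa [map_sub, sub_nonneg] at this

theorem compl (h : IsBandProjection π) : IsBandProjection (LinearMap.id - π) := by
  refine ⟨?_, fun x hx => ?_⟩
  · ext x
    simp [h.idem]
  · simpa using ⟨h.le_self hx, h.nonneg hx⟩

theorem apply_eq_self_of_le (h : IsBandProjection π) {z a : E} (hz : 0 ≤ z) (hza : z ≤ π a) :
    π z = z := by
  refine le_antisymm (h.le_self hz) ?_
  have := h.compl.mono hza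
  simpa [h.idem] using this

theorem apply_eq_zero_of_le (h : IsBandProjection π) {z a : E} (hz : 0 ≤ z) (hza : z ≤ a)
    (ha : π a = 0) : π z = 0 :=
  le_antisymm (ha ▸ h.mono hza) (h.nonneg hz)

theorem apply_inf_sub_apply (h : IsBandProjection π) {a b : E} (ha : 0 ≤ a) (hb : 0 ≤ b) :
    π a ⊓ (b - π b) = 0 := by
  have hz : 0 ≤ π a ⊓ (b - π b) := le_inf (h.nonneg ha) (sub_nonneg.2 (h.le_self hb))
  rw [← h.apply_eq_self_of_le hz inf_le_left]
  exact h.apply_eq_zero_of_le hz inf_le_right (by simp [h.idem])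

theorem abs_apply_le (h : IsBandProjection π) (x : E) : |π x| ≤ π |x| := by
  refine abs_le'.2 ⟨h.mono (le_abs_self x), ?_⟩
  rw [← map_neg]
  exact h.mono (neg_le_abs x)

theorem ext_of_nonneg {S T : E →ₗ[ℝ] E} (h : ∀ x, 0 ≤ x → S x = T x) : S = T := by
  ext x
  rw [← posPart_sub_negPart x, map_sub, map_sub, h _ (posPart_nonneg x), h _ (negPart_nonneg x)]

theorem comm (hπ : IsBandProjection π) (hρ : IsBandProjection ρ) : π.comp ρ = ρ.comp π := by
  refine ext_of_nonneg fun a ha => ?_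
  have h₁ : π (ρ (π a)) = ρ (π a) :=
    hπ.apply_eq_self_of_le (hρ.nonneg (hπ.nonneg ha)) (hρ.le_self (hπ.nonneg ha))
  have h₂ : π (ρ (a - π a)) = 0 :=
    hπ.apply_eq_zero_of_le (hρ.nonneg (hπ.compl.nonneg ha)) (hρ.le_self (hπ.compl.nonneg ha))
      (by simp [hπ.idem])
  rw [map_sub, map_sub, h₁, sub_eq_zero] at h₂
  exact h₂

theorem comm_apply (hπ : IsBandProjection π) (hρ : IsBandProjection ρ) (x : E) :
    π (ρ x) = ρ (π x) :=
  LinearMap.congr_fun (hπ.comm hρ) x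

theorem comp (hπ : IsBandProjection π) (hρ : IsBandProjection ρ) :
    IsBandProjection (π.comp ρ) := by
  refine ⟨?_, fun x hx => ⟨hπ.nonneg (hρ.nonneg hx),
    (hπ.le_self (hρ.nonneg hx)).trans (hρ.le_self hx)⟩⟩
  ext x
  simp [hρ.comm_apply hπ, hπ.idem, hρ.idem]

theorem id : IsBandProjection (LinearMap.id : E →ₗ[ℝ] E) := by
  simpa using (zero (E := E)).compl

theorem sup (hπ : IsBandProjection π) (hρ : IsBandProjection ρ) :
    IsBandProjection (π + ρ - π.comp ρ) :=
  sup_eq π ρ ▸ (hπ.compl.comp hρ.compl).compl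

/-- A space with the projection property has a complete Boolean algebra of band projections. -/
theorem exists_sup
    (hProj : ∀ B : Set E, IsBand B →
      ∃ π : E →ₗ[ℝ] E, IsBandProjection π ∧ Set.range ⇑π = B)
    (S : Set (E →ₗ[ℝ] E)) (hS : ∀ π ∈ S, IsBandProjection π) :
    ∃ σ : E →ₗ[ℝ] E, IsBandProjection σ ∧ (∀ π ∈ S, π.comp σ = π) ∧
      ∀ τ, IsBandProjection τ → (∀ π ∈ S, π.comp τ = π) → σ.comp τ = σ := by
  set M : Set E := {x | ∃ π ∈ S, ∃ y, π y = x}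
  obtain ⟨σ, hσ, hσM⟩ := hProj (disjComplement (disjComplement M))
    ⟨_, ⟨0, fun y _ => by simp⟩, rfl⟩
  refine ⟨σ, hσ, fun π hπ => ?_, fun τ hτ hSτ => ?_⟩
  · rw [(hS π hπ).comm hσ]
    ext x
    have hx : π x ∈ Set.range σ := by
      rw [hσM]
      intro y hy
      rw [inf_comm]
      exact hy _ ⟨π, hπ, x, rfl⟩
    obtain ⟨y, hy⟩ := hx
    rw [LinearMap.comp_apply, ← hy, hσ.idem]
  · refine ext_of_nonneg fun a ha => ?_
    set w := σ a - τ (σ a) with hw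
    have hw₀ : 0 ≤ w := hτ.compl.nonneg (hσ.nonneg ha)
    have hwM : w ∈ disjComplement M := by
      rintro _ ⟨π, hπ, y, rfl⟩
      have hπτ : τ (π |y|) = π |y| := by
        rw [hτ.comm_apply (hS π hπ)]
        exact LinearMap.congr_fun (hSτ π hπ) _
      refine le_antisymm ?_ (le_inf (abs_nonneg _) (abs_nonneg _))
      rw [abs_of_nonneg hw₀, inf_comm]
      refine (inf_le_inf_right _ ((hS π hπ).abs_apply_le y)).trans ?_
      rw [← hπτ]
      exact (hτ.apply_inf_sub_apply ((hS π hπ).nonneg (abs_nonneg y)) (hσ.nonneg ha)).le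
    have hwB : w ∈ disjComplement (disjComplement M) := by
      rw [← hσM]
      exact ⟨a - τ a, by rw [map_sub, hσ.comm_apply hτ]⟩
    have := hwB w hwM
    rw [inf_idem, abs_of_nonneg hw₀, hw, sub_eq_zero] at this
    rw [LinearMap.comp_apply, hσ.comm_apply hτ, ← this]

/-- A band projection vanishing on a set of positive elements generating the whole space as
a band is zero. -/
theorem eq_zero_of_forall_mem (hπ : IsBandProjection π) {M : Set E}
    (hM : disjComplement (disjComplement M) = Set.univ) (hpos : ∀ m ∈ M, 0 ≤ m)
    (h : ∀ m ∈ M, π m = 0) : π = 0 := by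
  refine ext_of_nonneg fun a ha => ?_
  have hd : π a ∈ disjComplement M := fun m hm => by
    have := hπ.apply_inf_sub_apply ha (hpos m hm)
    rwa [h m hm, sub_zero, ← abs_of_nonneg (hπ.nonneg ha), ← abs_of_nonneg (hpos m hm)] at this
  have := (hM ▸ Set.mem_univ (π a) : π a ∈ disjComplement (disjComplement M)) _ hd
  rwa [inf_idem, abs_of_nonneg (hπ.nonneg ha)] at this

end IsBandProjection

/-- A d-decomposable `E`-valued norm on `X`. -/
structure IsDecomposableNorm [Lattice E] [AddCommGroup E] [Module ℝ E] [AddCommGroup X]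
    [Module ℝ X] (nrm : X → E) : Prop where
  nonneg : ∀ x, 0 ≤ nrm x
  eq_zero_iff : ∀ x, nrm x = 0 ↔ x = 0
  smul : ∀ (c : ℝ) (x : X), nrm (c • x) = |c| • nrm x
  add_le : ∀ x y, nrm (x + y) ≤ nrm x + nrm y
  decomp : ∀ (x : X) (e₁ e₂ : E), 0 ≤ e₁ → 0 ≤ e₂ → e₁ ⊓ e₂ = 0 →
    nrm x = e₁ + e₂ → ∃ x₁ x₂ : X, x = x₁ + x₂ ∧ nrm x₁ = e₁ ∧ nrm x₂ = e₂

namespace IsDecomposableNorm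

variable [Lattice E] [AddCommGroup E] [IsOrderedAddMonoid E] [Module ℝ E] [AddCommGroup X]
  [Module ℝ X] {nrm : X → E} {π ρ : E →ₗ[ℝ] E}

/-- The subspace of vectors whose norm is annihilated by a band projection. -/
def annihilated (hn : IsDecomposableNorm nrm) (hπ : IsBandProjection π) : Submodule ℝ X where
  carrier := {x | π (nrm x) = 0}
  zero_mem' := by simp [(hn.eq_zero_iff 0).2 rfl]
  add_mem' {x y} hx hy := by
    refine hπ.apply_eq_zero_of_le (hn.nonneg _) (hn.add_le x y) ?_
    rw [map_add, hx, hy, add_zero]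
  smul_mem' c x hx := by
    simp only [Set.mem_ofPred_eq] at hx ⊢
    rw [hn.smul, map_smul, hx, smul_zero]

theorem mem_annihilated (hn : IsDecomposableNorm nrm) (hπ : IsBandProjection π) {x : X} :
    x ∈ hn.annihilated hπ ↔ π (nrm x) = 0 := Iff.rfl

theorem mem_annihilated_compl (hn : IsDecomposableNorm nrm) (hπ : IsBandProjection π) {x : X} :
    x ∈ hn.annihilated hπ.compl ↔ π (nrm x) = nrm x := by
  rw [mem_annihilated, LinearMap.sub_apply, LinearMap.id_apply, sub_eq_zero, eq_comm]

theorem exists_decomp (hn : IsDecomposableNorm nrm) (hπ : IsBandProjection π) (x : X) :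
    ∃ y, nrm y = π (nrm x) ∧ y ∈ hn.annihilated hπ.compl ∧ x - y ∈ hn.annihilated hπ := by
  obtain ⟨y, z, rfl, hy, hz⟩ := hn.decomp x (π (nrm x)) (nrm x - π (nrm x))
    (hπ.nonneg (hn.nonneg x)) (hπ.compl.nonneg (hn.nonneg x))
    (hπ.apply_inf_sub_apply (hn.nonneg x) (hn.nonneg x)) (by abel)
  refine ⟨y, hy, ?_, ?_⟩
  · rw [hn.mem_annihilated_compl hπ, hy, hπ.idem]
  · rw [mem_annihilated, add_sub_cancel_left, hz, map_sub, hπ.idem, sub_self]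

theorem isCompl (hn : IsDecomposableNorm nrm) (hπ : IsBandProjection π) :
    IsCompl (hn.annihilated hπ.compl) (hn.annihilated hπ) := by
  constructor
  · rw [Submodule.disjoint_def]
    intro x hx hx'
    rw [hn.mem_annihilated_compl hπ] at hx
    rw [mem_annihilated, hx, hn.eq_zero_iff] at hx'
    exact hx'
  · rw [codisjoint_iff, eq_top_iff]
    intro x _
    obtain ⟨y, -, hy, hz⟩ := hn.exists_decomp hπ x
    exact Submodule.mem_sup.2 ⟨y, hy, x - y, hz, add_sub_cancel y x⟩

open Classical in
/-- The projection of `X` induced by a band projection of `E` (and zero for other operators). -/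
noncomputable def proj (hn : IsDecomposableNorm nrm) (π : E →ₗ[ℝ] E) : X →ₗ[ℝ] X :=
  if hπ : IsBandProjection π then Submodule.projection _ _ (hn.isCompl hπ) else 0

theorem proj_apply_eq (hn : IsDecomposableNorm nrm) (hπ : IsBandProjection π) {x y : X}
    (hy : y ∈ hn.annihilated hπ.compl) (hxy : x - y ∈ hn.annihilated hπ) :
    hn.proj π x = y := by
  rw [proj, dif_pos hπ, ← add_sub_cancel y x, map_add,
    Submodule.projection_apply_of_mem_left _ hy,
    Submodule.projection_apply_of_mem_right _ hxy, add_zero]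

theorem norm_proj (hn : IsDecomposableNorm nrm) (hπ : IsBandProjection π) (x : X) :
    nrm (hn.proj π x) = π (nrm x) := by
  obtain ⟨y, h, hy, hz⟩ := hn.exists_decomp hπ x
  rw [hn.proj_apply_eq hπ hy hz, h]

theorem proj_mem (hn : IsDecomposableNorm nrm) (hπ : IsBandProjection π) (x : X) :
    hn.proj π x ∈ hn.annihilated hπ.compl := by
  rw [hn.mem_annihilated_compl hπ, hn.norm_proj hπ, hπ.idem]

theorem sub_proj_mem (hn : IsDecomposableNorm nrm) (hπ : IsBandProjection π) (x : X) :
    x - hn.proj π x ∈ hn.annihilated hπ := by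
  obtain ⟨y, h, hy, hz⟩ := hn.exists_decomp hπ x
  rwa [hn.proj_apply_eq hπ hy hz]

theorem proj_comp (hn : IsDecomposableNorm nrm) (hπ : IsBandProjection π)
    (hρ : IsBandProjection ρ) : hn.proj (π.comp ρ) = (hn.proj π).comp (hn.proj ρ) := by
  ext x
  refine hn.proj_apply_eq (hπ.comp hρ) ?_ ?_
  · rw [hn.mem_annihilated_compl (hπ.comp hρ), LinearMap.comp_apply, LinearMap.comp_apply, hn.norm_proj hπ,
      hn.norm_proj hρ, hρ.comm_apply hπ, hρ.idem, hπ.idem]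
  · rw [LinearMap.comp_apply, ← sub_add_sub_cancel x (hn.proj ρ x)]
    refine Submodule.add_mem _ ?_ ?_
    · have := hn.sub_proj_mem hρ x
      rw [mem_annihilated] at this ⊢
      rw [LinearMap.comp_apply, this, map_zero]
    · have := hn.sub_proj_mem hπ (hn.proj ρ x)
      rw [mem_annihilated] at this ⊢
      rw [LinearMap.comp_apply, hπ.comm_apply hρ, this, map_zero]

theorem proj_compl (hn : IsDecomposableNorm nrm) (hπ : IsBandProjection π) :
    hn.proj (LinearMap.id - π) = LinearMap.id - hn.proj π := by
  ext x
  refine hn.proj_apply_eq hπ.compl ?_ ?_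
  · rw [hn.mem_annihilated_compl hπ.compl, LinearMap.sub_apply, LinearMap.id_apply, LinearMap.sub_apply,
      LinearMap.id_apply, (hn.mem_annihilated hπ).1 (hn.sub_proj_mem hπ x), sub_zero]
  · simpa using hn.proj_mem hπ x

theorem proj_zero (hn : IsDecomposableNorm nrm) : hn.proj 0 = 0 := by
  ext x
  rw [LinearMap.zero_apply, ← hn.eq_zero_iff, hn.norm_proj IsBandProjection.zero,
    LinearMap.zero_apply]

theorem proj_id (hn : IsDecomposableNorm nrm) : hn.proj LinearMap.id = LinearMap.id := by
  have := hn.proj_compl IsBandProjection.zero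
  rwa [proj_zero, sub_zero, sub_zero] at this

theorem proj_sup (hn : IsDecomposableNorm nrm) (hπ : IsBandProjection π)
    (hρ : IsBandProjection ρ) : hn.proj (π + ρ - π.comp ρ) =
      hn.proj π + hn.proj ρ - (hn.proj π).comp (hn.proj ρ) := by
  rw [IsBandProjection.sup_eq, hn.proj_compl (hπ.compl.comp hρ.compl),
    hn.proj_comp hπ.compl hρ.compl, hn.proj_compl hπ, hn.proj_compl hρ]
  ext x
  simp
  abel

theorem comp_eq_of_proj_eq (hn : IsDecomposableNorm nrm)
    (hgen : disjComplement (disjComplement (Set.range nrm)) = Set.univ)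
    (hπ : IsBandProjection π) (hρ : IsBandProjection ρ) (h : hn.proj π = hn.proj ρ) :
    π = π.comp ρ := by
  have := (hπ.comp hρ.compl).eq_zero_of_forall_mem hgen
    (by rintro _ ⟨x, rfl⟩; exact hn.nonneg x) (by
      rintro _ ⟨x, rfl⟩
      rw [LinearMap.comp_apply, LinearMap.sub_apply, LinearMap.id_apply, ← hn.norm_proj hρ, ← h,
        hn.norm_proj hπ, map_sub, hπ.idem, sub_self])
  rwa [LinearMap.comp_sub, LinearMap.comp_id, sub_eq_zero] at this

theorem proj_injOn (hn : IsDecomposableNorm nrm)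
    (hgen : disjComplement (disjComplement (Set.range nrm)) = Set.univ)
    (hπ : IsBandProjection π) (hρ : IsBandProjection ρ) (h : hn.proj π = hn.proj ρ) :
    π = ρ := by
  rw [hn.comp_eq_of_proj_eq hgen hπ hρ h, hπ.comm hρ, ← hn.comp_eq_of_proj_eq hgen hρ hπ h.symm]

end IsDecomposableNorm

theorem decomposable_latticeNormedSpace_boolean_algebra_of_projections
    [Lattice E] [AddCommGroup E] [Module ℝ E]
    [CovariantClass E E (· + ·) (· ≤ ·)] [PosSMulMono ℝ E]
    [AddCommGroup X] [Module ℝ X]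
    (hArch : ∀ x y : E, (∀ n : ℕ, n • x ≤ y) → x ≤ 0)
    (hProj : ∀ B : Set E, IsBand B →
      ∃ π : E →ₗ[ℝ] E, IsBandProjection π ∧ Set.range ⇑π = B)
    (nrm : X → E)
    (hpos : ∀ x : X, 0 ≤ nrm x)
    (hzero : ∀ x : X, nrm x = 0 ↔ x = 0)
    (hsmul : ∀ (c : ℝ) (x : X), nrm (c • x) = |c| • nrm x)
    (htriangle : ∀ x y : X, nrm (x + y) ≤ nrm x + nrm y)
    -- d-decomposability:
    (hdec : ∀ (x : X) (e₁ e₂ : E), 0 ≤ e₁ → 0 ≤ e₂ → e₁ ⊓ e₂ = 0 →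
      nrm x = e₁ + e₂ → ∃ x₁ x₂ : X, x = x₁ + x₂ ∧ nrm x₁ = e₁ ∧ nrm x₂ = e₂)
    -- `E = ⟦X⟧^⊥⊥`:
    (hgen : disjComplement (disjComplement (Set.range nrm)) = Set.univ) :
    ∃ (ℬ : Set (X →ₗ[ℝ] X)) (h : (E →ₗ[ℝ] E) → (X →ₗ[ℝ] X)),
      -- ℬ is a Boolean algebra of commuting idempotent linear operators on X:
      (∀ b ∈ ℬ, b.comp b = b) ∧
      (∀ b ∈ ℬ, ∀ c ∈ ℬ, b.comp c = c.comp b) ∧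
      (∀ b ∈ ℬ, ∀ c ∈ ℬ, b.comp c ∈ ℬ ∧ b + c - b.comp c ∈ ℬ) ∧
      (∀ b ∈ ℬ, LinearMap.id - b ∈ ℬ) ∧
      ((0 : X →ₗ[ℝ] X) ∈ ℬ) ∧ ((LinearMap.id : X →ₗ[ℝ] X) ∈ ℬ) ∧
      -- ℬ is complete (every subset has a supremum in the order b ≤ c ↔ b ∘ c = b):
      (∀ A : Set (X →ₗ[ℝ] X), A ⊆ ℬ → ∃ s ∈ ℬ, (∀ b ∈ A, b.comp s = b) ∧
        ∀ c ∈ ℬ, (∀ b ∈ A, b.comp c = b) → s.comp c = s) ∧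
      -- h is a bijection of 𝔓(E) onto ℬ:
      (∀ π : E →ₗ[ℝ] E, IsBandProjection π → h π ∈ ℬ) ∧
      (∀ π ρ : E →ₗ[ℝ] E, IsBandProjection π → IsBandProjection ρ → h π = h ρ → π = ρ) ∧
      (∀ b ∈ ℬ, ∃ π : E →ₗ[ℝ] E, IsBandProjection π ∧ h π = b) ∧
      -- h is a Boolean homomorphism:
      (∀ π ρ : E →ₗ[ℝ] E, IsBandProjection π → IsBandProjection ρ →
        h (π.comp ρ) = (h π).comp (h ρ) ∧
        h (π + ρ - π.comp ρ) = h π + h ρ - (h π).comp (h ρ)) ∧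
      (∀ π : E →ₗ[ℝ] E, IsBandProjection π →
        h (LinearMap.id - π) = LinearMap.id - h π) ∧
      (h 0 = 0) ∧ (h LinearMap.id = LinearMap.id) ∧
      -- compatibility with the vector norm:
      (∀ π : E →ₗ[ℝ] E, IsBandProjection π → ∀ x : X, π (nrm x) = nrm (h π x)) := by
  have : IsOrderedAddMonoid E :=
    { add_le_add_left := fun a b hab c => by
        rw [add_comm a, add_comm b]
        exact CovariantClass.elim c hab }
  have hn : IsDecomposableNorm nrm := ⟨hpos, hzero, hsmul, htriangle, hdec⟩
  refine ⟨hn.proj '' {π | IsBandProjection π}, hn.proj, ?_, ?_, ?_, ?_,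
    ⟨0, .zero, hn.proj_zero⟩, ⟨_, .id, hn.proj_id⟩, ?_, fun π hπ => ⟨π, hπ, rfl⟩,
    fun π ρ hπ hρ => hn.proj_injOn hgen hπ hρ, fun b hb => hb,
    fun π ρ hπ hρ => ⟨hn.proj_comp hπ hρ, hn.proj_sup hπ hρ⟩, fun π hπ => hn.proj_compl hπ,
    hn.proj_zero, hn.proj_id, fun π hπ x => (hn.norm_proj hπ x).symm⟩
  · rintro _ ⟨π, hπ, rfl⟩
    rw [← hn.proj_comp hπ hπ, hπ.1]
  · rintro _ ⟨π, hπ, rfl⟩ _ ⟨ρ, hρ, rfl⟩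
    rw [← hn.proj_comp hπ hρ, ← hn.proj_comp hρ hπ, IsBandProjection.comm hπ hρ]
  · rintro _ ⟨π, hπ, rfl⟩ _ ⟨ρ, hρ, rfl⟩
    exact ⟨⟨_, IsBandProjection.comp hπ hρ, hn.proj_comp hπ hρ⟩,
      ⟨_, IsBandProjection.sup hπ hρ, hn.proj_sup hπ hρ⟩⟩
  · rintro _ ⟨π, hπ, rfl⟩
    exact ⟨_, IsBandProjection.compl hπ, hn.proj_compl hπ⟩
  · intro A hA
    obtain ⟨σ, hσ, hub, hlub⟩ := IsBandProjection.exists_sup hProj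
      {π | IsBandProjection π ∧ hn.proj π ∈ A} fun π hπ => hπ.1
    refine ⟨_, ⟨σ, hσ, rfl⟩, fun b hb => ?_, ?_⟩
    · obtain ⟨π, hπ, rfl⟩ := hA hb
      rw [← hn.proj_comp hπ hσ, hub π ⟨hπ, hb⟩]
    · rintro _ ⟨τ, hτ, rfl⟩ hAτ
      rw [← hn.proj_comp hσ hτ, hlub τ hτ fun π hπ => ?_]
      refine hn.proj_injOn hgen (hπ.1.comp hτ) hπ.1 ?_
      rw [hn.proj_comp hπ.1 hτ, hAτ _ hπ.2]
end
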